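/- Let G be a three-player LTL game (Ag = {1,2,3}) with empty strong core. Then there does not exist a strategy profile σ on G whose run ρ(σ) satisfies exactly two of the goals γ_1, γ_2, γ_3. -/

import Mathlib

/-- A concurrent game structure over a set of agents `Ag`, states `St`, and,
for each agent `i`, a set of actions `Ac i`.  It consists of an initial state
and a transition function. -/
structure CGS (Ag St : Type) (Ac : Ag → Type) where
  init : St
  tr : St → (∀ i, Ac i) → St

/-- A strategy for a player with actions `A`: it maps finite (nonempty)
histories of states, given as lists, to an action. -/
abbrev Strategy (St A : Type) := List St → A

/-- A strategy profile: one strategy for each player. -/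
abbrev Profile {Ag : Type} (St : Type) (Ac : Ag → Type) := ∀ i, Strategy St (Ac i)

namespace CGS

variable {Ag St : Type} {Ac : Ag → Type}

/-- The history `ρ(σ)[0 … t]` (as a list) together with the current state
`ρ(σ)[t]` of the run induced by a strategy profile `σ`. -/
def histRun (M : CGS Ag St Ac) (σ : Profile St Ac) : ℕ → List St × St
  | 0 => ([M.init], M.init)
  | t + 1 =>
      let p := histRun M σ t
      let s := M.tr p.2 (fun i => σ i p.1)
      (p.1 ++ [s], s)

/-- The unique run `ρ(σ)` induced by a strategy profile `σ`. -/
def run (M : CGS Ag St Ac) (σ : Profile St Ac) (t : ℕ) : St :=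
  (histRun M σ t).2

/-- A run of `M`: an infinite state sequence starting at the initial state in
which every step is obtained by some action profile. -/
def IsRun (M : CGS Ag St Ac) (ρ : ℕ → St) : Prop :=
  ρ 0 = M.init ∧ ∀ t, ∃ a : ∀ i, Ac i, ρ (t + 1) = M.tr (ρ t) a

end CGS

open Classical in
/-- Combine a joint strategy `σC` for a coalition `C` with strategies `σN`
for the players outside `C`, obtaining a full strategy profile. -/
noncomputable def combine {Ag St : Type} {Ac : Ag → Type} (C : Set Ag)
    (σC : ∀ i ∈ C, Strategy St (Ac i)) (σN : ∀ i ∉ C, Strategy St (Ac i)) :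
    Profile St Ac :=
  fun i => if h : i ∈ C then σC i h else σN i h

/-- Syntax of Linear Temporal Logic over atomic propositions `AP`:
atoms, negation, disjunction, next, and until. -/
inductive LTLFormula (AP : Type) where
  | atom : AP → LTLFormula AP
  | neg  : LTLFormula AP → LTLFormula AP
  | disj : LTLFormula AP → LTLFormula AP → LTLFormula AP
  | next : LTLFormula AP → LTLFormula AP
  | untl : LTLFormula AP → LTLFormula AP → LTLFormula AP

/-- Standard LTL semantics over infinite runs `ρ : ℕ → St`, via a labelling
function `lab : St → Set AP`. -/
def LTLFormula.Sat {AP St : Type} (lab : St → Set AP) :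
    LTLFormula AP → (ℕ → St) → Prop
  | .atom p, ρ => p ∈ lab (ρ 0)
  | .neg φ, ρ => ¬ LTLFormula.Sat lab φ ρ
  | .disj φ ψ, ρ => LTLFormula.Sat lab φ ρ ∨ LTLFormula.Sat lab ψ ρ
  | .next φ, ρ => LTLFormula.Sat lab φ (fun t => ρ (t + 1))
  | .untl φ ψ, ρ =>
      ∃ j : ℕ, LTLFormula.Sat lab ψ (fun t => ρ (t + j)) ∧
        ∀ k < j, LTLFormula.Sat lab φ (fun t => ρ (t + k))

/-- An LTL game: a concurrent game structure together with a labelling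
function and an LTL goal for each player. -/
structure LTLGame (Ag St : Type) (Ac : Ag → Type) (AP : Type) where
  M : CGS Ag St Ac
  lab : St → Set AP
  goal : Ag → LTLFormula AP

namespace LTLGame

variable {Ag St AP : Type} {Ac : Ag → Type}

/-- The winners of a run: players whose goal is satisfied by the run. -/
def winners (G : LTLGame Ag St Ac AP) (ρ : ℕ → St) : Set Ag :=
  {i | (G.goal i).Sat G.lab ρ}

/-- `σC` is a beneficial deviation for the (nonempty) coalition `C` from the
strategy profile `σ`: every member of `C` loses under `σ`, and all members of
`C` win under `(σC, σN)` no matter which joint strategy `σN` the remaining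
players use. -/
def BeneficialDeviation (G : LTLGame Ag St Ac AP) (C : Set Ag)
    (σ : Profile St Ac) (σC : ∀ i ∈ C, Strategy St (Ac i)) : Prop :=
  C.Nonempty ∧
  C ⊆ (G.winners (G.M.run σ))ᶜ ∧
  ∀ σN : ∀ i ∉ C, Strategy St (Ac i), C ⊆ G.winners (G.M.run (combine C σC σN))

/-- A strategy profile is in the core iff no coalition has a beneficial
deviation from it. -/
def inCore (G : LTLGame Ag St Ac AP) (σ : Profile St Ac) : Prop :=
  ∀ (C : Set Ag) (σC : ∀ i ∈ C, Strategy St (Ac i)),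
    ¬ G.BeneficialDeviation C σ σC

/-- A (nonempty) coalition `C` is fulfilled if it has a joint strategy
guaranteeing all goals of its members, against every joint strategy of the
remaining players. -/
def Fulfilled (G : LTLGame Ag St Ac AP) (C : Set Ag) : Prop :=
  C.Nonempty ∧
  ∃ σC : ∀ i ∈ C, Strategy St (Ac i),
    ∀ σN : ∀ i ∉ C, Strategy St (Ac i),
      C ⊆ G.winners (G.M.run (combine C σC σN))

/-- `σC` is a strong beneficial deviation for the (nonempty) coalition `C`
from `σ`: (1) all members of `C` lose under `σ`; (2) all members of `C` win
under `(σ₋C, σC)`; (3) against every counter joint strategy `σN` under which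
all original winners still win, all members of `C` win. -/
def StrongBeneficialDeviation (G : LTLGame Ag St Ac AP) (C : Set Ag)
    (σ : Profile St Ac) (σC : ∀ i ∈ C, Strategy St (Ac i)) : Prop :=
  C.Nonempty ∧
  C ⊆ (G.winners (G.M.run σ))ᶜ ∧
  C ⊆ G.winners (G.M.run (combine C σC (fun i _ => σ i))) ∧
  ∀ σN : ∀ i ∉ C, Strategy St (Ac i),
    G.winners (G.M.run σ) ⊆ G.winners (G.M.run (combine C σC σN)) →
      C ⊆ G.winners (G.M.run (combine C σC σN))

/-- A strategy profile is in the strong core iff no coalition has a strong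
beneficial deviation from it. -/
def inStrongCore (G : LTLGame Ag St Ac AP) (σ : Profile St Ac) : Prop :=
  ∀ (C : Set Ag) (σC : ∀ i ∈ C, Strategy St (Ac i)),
    ¬ G.StrongBeneficialDeviation C σ σC

/-- `(G, φ) ∈ E-Core` iff some member of the core of `G` induces a run
satisfying `φ`. -/
def ECore (G : LTLGame Ag St Ac AP) (φ : LTLFormula AP) : Prop :=
  ∃ σ : Profile St Ac, G.inCore σ ∧ φ.Sat G.lab (G.M.run σ)

end LTLGame

/-! ### Strong deviations in abstract three-player games

A game is given by strategy types `S i` and a predicate `w σ i`: player `i` wins under `σ`. -/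

namespace ThreePlayer

variable {S : Fin 3 → Type} {w : (∀ i, S i) → Fin 3 → Prop}

/-- The coalition `C`, by moving from `σ` to `τ`, makes a strong beneficial deviation. -/
def StrongDev (w : (∀ i, S i) → Fin 3 → Prop) (σ : ∀ i, S i) (C : Set (Fin 3))
    (τ : ∀ i, S i) : Prop :=
  C.Nonempty ∧ (∀ i ∉ C, τ i = σ i) ∧ (∀ i ∈ C, ¬ w σ i) ∧ (∀ i ∈ C, w τ i) ∧
    ∀ σ' : ∀ i, S i, (∀ i ∈ C, σ' i = τ i) → (∀ j, w σ j → w σ' j) → ∀ i ∈ C, w σ' i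

/-- Playing `s`, player `i` prevents the two other players from both winning. -/
def Prevents (w : (∀ i, S i) → Fin 3 → Prop) (i : Fin 3) (s : S i) : Prop :=
  ∀ σ : ∀ i, S i, σ i = s → ∃ j, j ≠ i ∧ ¬ w σ j

/-- Playing `s`, player `i` wins whenever `j` does. -/
def Covers (w : (∀ i, S i) → Fin 3 → Prop) (i j : Fin 3) (s : S i) : Prop :=
  ∀ σ : ∀ i, S i, σ i = s → w σ j → w σ i

theorem exists_third (i j : Fin 3) (h : i ≠ j) :
    ∃ k, k ≠ i ∧ k ≠ j ∧ ∀ x, x = i ∨ x = j ∨ x = k := by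
  revert i j; decide

theorem exists_loser (H : ∀ σ, ∃ C τ, StrongDev w σ C τ) (σ : ∀ i, S i) : ∃ i, ¬ w σ i := by
  obtain ⟨C, τ, ⟨i, hi⟩, -, hl, -⟩ := H σ
  exact ⟨i, hl i hi⟩

theorem Covers.prevents (H : ∀ σ, ∃ C τ, StrongDev w σ C τ) {i j : Fin 3} {s : S i}
    (h : Covers w i j s) (hij : j ≠ i) : Prevents w i s := by
  intro σ hσ
  by_contra! hw
  obtain ⟨k, hk⟩ := exists_loser H σ
  obtain rfl | hki := eq_or_ne k i
  · exact hk (h σ hσ (hw j hij))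
  · exact hk (hw k hki)

theorem exists_prevents [∀ i, Nonempty (S i)] (H : ∀ σ, ∃ C τ, StrongDev w σ C τ)
    (i : Fin 3) : ∃ s, Prevents w i s := by
  by_cases hex : ∃ σ, ∀ j, j ≠ i → w σ j
  · obtain ⟨σ, hσ⟩ := hex
    obtain ⟨C, τ, ⟨k, hk⟩, -, hl, -, hd⟩ := H σ
    have hC : ∀ x ∈ C, x = i := fun x hx => by
      by_contra h
      exact hl x hx (hσ x h)
    obtain rfl := hC k hk
    refine ⟨τ k, fun σ' hσ' => ?_⟩
    by_contra! hw
    have hwk := hd σ' (fun x hx => by rw [hC x hx, hσ'])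
      (fun j hj => hw j fun h => hl k hk (h ▸ hj)) k hk
    obtain ⟨x, hx⟩ := exists_loser H σ'
    obtain rfl | hxk := eq_or_ne x k
    · exact hx hwk
    · exact hx (hw x hxk)
  · push Not at hex
    exact ⟨Classical.arbitrary _, fun σ _ => hex σ⟩

theorem winner_unique {σ : ∀ i, S i} (hσ : ∀ i, Prevents w i (σ i)) {i j : Fin 3}
    (hi : w σ i) (hj : w σ j) : i = j := by
  by_contra hij
  obtain ⟨k, -, -, h3⟩ := exists_third i j hij
  obtain ⟨x, hxk, hx⟩ := hσ k σ rfl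
  obtain rfl | rfl | rfl := h3 x
  exacts [hx hi, hx hj, hxk rfl]

/-- No player can guarantee a win while the two others play preventing strategies. -/
theorem not_guarantees (H : ∀ σ, ∃ C τ, StrongDev w σ C τ) {σ : ∀ i, S i} {i : Fin 3}
    (hσ : ∀ j, j ≠ i → Prevents w j (σ j)) : ∃ σ' : ∀ i, S i, σ' i = σ i ∧ ¬ w σ' i := by
  by_contra! hg
  obtain ⟨C, τ, ⟨j, hj⟩, hτ, hl, hw, -⟩ := H σ
  have hiC : i ∉ C := fun h => hl i h (hg σ rfl)
  have hwi := hg τ (hτ i hiC)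
  obtain ⟨k, hki, -, h3⟩ := exists_third i j fun h => hiC (h ▸ hj)
  by_cases hk : k ∈ C
  · obtain ⟨x, hx⟩ := exists_loser H τ
    obtain rfl | rfl | rfl := h3 x
    exacts [hx hwi, hx (hw _ hj), hx (hw _ hk)]
  · obtain ⟨x, hxk, hx⟩ := hσ k hki τ (hτ k hk)
    obtain rfl | rfl | rfl := h3 x
    exacts [hx hwi, hx (hw _ hj), hxk rfl]

theorem exists_winner (H : ∀ σ, ∃ C τ, StrongDev w σ C τ) {σ : ∀ i, S i}
    (hσ : ∀ i, Prevents w i (σ i)) : ∃ i, w σ i := by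
  by_contra! hn
  obtain ⟨C, τ, ⟨i, hi⟩, hτ, -, hw, hd⟩ := H σ
  have hC : ∀ j ∈ C, j = i := by
    intro j hj
    by_contra hij
    obtain ⟨k, -, -, h3⟩ := exists_third j i hij
    by_cases hk : k ∈ C
    · obtain ⟨x, hx⟩ := exists_loser H τ
      obtain rfl | rfl | rfl := h3 x
      exacts [hx (hw _ hj), hx (hw _ hi), hx (hw _ hk)]
    · obtain ⟨x, hxk, hx⟩ := hσ k τ (hτ k hk)
      obtain rfl | rfl | rfl := h3 x
      exacts [hx (hw _ hj), hx (hw _ hi), hxk rfl]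
  obtain ⟨σ', hσ', hl⟩ := not_guarantees H (σ := τ) (i := i) fun j hj => by
    rw [hτ j fun h => hj (hC j h)]
    exact hσ j
  exact hl (hd σ' (fun j hj => by rw [hC j hj, hσ']) (fun j hj => absurd hj (hn j)) i hi)

/-- When all players prevent and `v` wins, some other player deviates alone, covering `v`. -/
theorem exists_covers (H : ∀ σ, ∃ C τ, StrongDev w σ C τ) {σ : ∀ i, S i}
    (hσ : ∀ i, Prevents w i (σ i)) {v : Fin 3} (hv : w σ v) :
    ∃ u τ, u ≠ v ∧ (∀ i, i ≠ u → τ i = σ i) ∧ Covers w u v (τ u) ∧ w τ u ∧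
      ∀ i, Prevents w i (τ i) := by
  obtain ⟨C, τ, ⟨u, hu⟩, hτ, hl, hw, hd⟩ := H σ
  have hvC : v ∉ C := fun h => hl v h hv
  have huv : u ≠ v := fun h => hvC (h ▸ hu)
  obtain ⟨j, hjv, hj⟩ := hσ v τ (hτ v hvC)
  have hC : ∀ i ∈ C, i = u := by
    intro i hi
    obtain ⟨k, -, -, h3⟩ := exists_third u v huv
    obtain rfl | rfl | rfl := h3 i
    · rfl
    · exact absurd hi hvC
    · obtain rfl | rfl | rfl := h3 j
      exacts [absurd (hw _ hu) hj, absurd rfl hjv, absurd (hw _ hi) hj]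
  have hne : ∀ i, i ≠ u → τ i = σ i := fun i hi => hτ i fun h => hi (hC i h)
  have hcov : Covers w u v (τ u) := fun σ' hσ' hv' =>
    hd σ' (fun i hi => by rw [hC i hi, hσ'])
      (fun i hi => winner_unique hσ hv hi ▸ hv') u hu
  refine ⟨u, τ, huv, hne, hcov, hw u hu, fun i => ?_⟩
  obtain rfl | hi := eq_or_ne i u
  · exact hcov.prevents H huv.symm
  · rw [hne i hi]
    exact hσ i

theorem exists_no_strongDev [∀ i, Nonempty (S i)] : ∃ σ, ∀ C τ, ¬ StrongDev w σ C τ := by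
  by_contra! H
  choose σ hσ using exists_prevents H
  obtain ⟨v, hv⟩ := exists_winner H hσ
  obtain ⟨u, σ₁, huv, -, hcu, hwu, hp₁⟩ := exists_covers H hσ hv
  obtain ⟨x, σ₂, hxu, he₂, hcx, hwx, hp₂⟩ := exists_covers H hp₁ hwu
  obtain rfl | hxv := eq_or_ne x v
  · exact hxu (winner_unique hp₂ hwx (hcu σ₂ (he₂ u huv) hwx))
  obtain ⟨y, σ₃, hyx, he₃, -, hwy, hp₃⟩ := exists_covers H hp₂ hwx
  obtain rfl | hyu := eq_or_ne y u
  · exact hyx (winner_unique hp₃ hwy (hcx σ₃ (he₃ x hyx.symm) hwy))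
  · obtain ⟨k, -, -, h3⟩ := exists_third u v huv
    have hyv : y = v := by grind
    subst hyv
    exact hyu (winner_unique hp₃ hwy
      (hcu σ₃ ((he₃ u huv).trans (he₂ u hxu.symm)) hwy))

end ThreePlayer

theorem LTLGame.StrongBeneficialDeviation.strongDev {St AP : Type} {Ac : Fin 3 → Type}
    {G : LTLGame (Fin 3) St Ac AP} {C : Set (Fin 3)} {σ : Profile St Ac}
    {σC : ∀ i ∈ C, Strategy St (Ac i)} (h : G.StrongBeneficialDeviation C σ σC) :
    ThreePlayer.StrongDev (S := fun i => Strategy St (Ac i))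
      (fun σ i => i ∈ G.winners (G.M.run σ)) σ C (combine C σC fun i _ => σ i) := by
  obtain ⟨hne, hl, hw, hd⟩ := h
  refine ⟨hne, fun i hi => by simp [combine, hi], hl, hw, fun σ' hσ' hwin i hi => ?_⟩
  have he : combine C σC (fun i _ => σ' i) = σ' := by
    funext i
    by_cases hi : i ∈ C
    · rw [hσ' i hi]
      simp [combine, hi]
    · simp [combine, hi]
  have := hd fun i _ => σ' i
  rw [he] at this
  exact this hwin hi

/-- Let `G` be a three-player LTL game with empty strong core.
Then there is no strategy profile `σ` whose run satisfies exactly two of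
the goals, i.e. no `σ` whose winner set has exactly two elements. -/
theorem no_profile_with_exactly_two_winners_of_empty_strongCore
    {St AP : Type} {Ac : Fin 3 → Type}
    [Fintype St] [∀ i, Fintype (Ac i)] [∀ i, Nonempty (Ac i)] [Fintype AP]
    (G : LTLGame (Fin 3) St Ac AP)
    (hempty : ∀ σ : Profile St Ac,
      ∃ (C : Set (Fin 3)) (σC : ∀ i ∈ C, Strategy St (Ac i)),
        G.StrongBeneficialDeviation C σ σC) :
    ¬ ∃ σ : Profile St Ac, (G.winners (G.M.run σ)).ncard = 2 := by
  obtain ⟨σ, hσ⟩ := ThreePlayer.exists_no_strongDev (S := fun i => Strategy St (Ac i))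
    (w := fun σ i => i ∈ G.winners (G.M.run σ))
  obtain ⟨C, σC, h⟩ := hempty σ
  exact absurd h.strongDev (hσ C _)
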